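/- Let L and S be independent non-negative random variables with L \in RV_{-\beta}, S \in RV_{-\gamma}, \gamma + 1 < \beta. Assume x^{\gamma-\beta}\bar{F}_S(x)/\bar{F}_L(x) \to k > 0 as x \to \infty and F_S has a positive, non-increasing density on [x_0,\infty). Then VaR_\alpha(L+S) - VaR_\alpha(S) \to E[L] as \alpha \to 1. -/

import Mathlib

open MeasureTheory ProbabilityTheory Filter Topology

/-- Tail probability function of a random variable. -/
noncomputable def tail {Ω : Type*} [MeasurableSpace Ω] (P : Measure Ω) (X : Ω → ℝ) (x : ℝ) : ℝ :=
  (P {ω | x < X ω}).toReal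

/-- Distribution function of a random variable. -/
noncomputable def cdf' {Ω : Type*} [MeasurableSpace Ω] (P : Measure Ω) (X : Ω → ℝ) (x : ℝ) : ℝ :=
  (P {ω | X ω ≤ x}).toReal

/-- Value at Risk: the α-quantile. -/
noncomputable def VaR {Ω : Type*} [MeasurableSpace Ω] (P : Measure Ω) (X : Ω → ℝ) (α : ℝ) : ℝ :=
  sInf {x : ℝ | α ≤ cdf' P X x}

/-- f is regularly varying (at infinity) with index k. -/
def RegVary (f : ℝ → ℝ) (k : ℝ) : Prop :=
  ∀ t : ℝ, 0 < t → Tendsto (fun x => f (t * x) / f x) atTop (𝓝 (t ^ k))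

/-- Monotone density theorem: a non-increasing density of a regularly varying tail of index `-γ`
satisfies `x f(x) / G(x) → γ`. -/
lemma tendsto_mul_density_div_tail {G f : ℝ → ℝ} {γ x₀ : ℝ}
    (hGpos : ∀ x, 0 < G x) (hG : RegVary G (-γ))
    (hdiff : ∀ a b, x₀ ≤ a → x₀ ≤ b → (b - a) * f b ≤ G a - G b ∧ G a - G b ≤ (b - a) * f a) :
    Tendsto (fun x => x * f x / G x) atTop (𝓝 γ) := by
  have hslope : Tendsto (fun t : ℝ => (t ^ (-γ) - 1) / (1 - t)) (𝓝[≠] 1) (𝓝 γ) := by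
    have h := (Real.hasDerivAt_rpow_const (x := 1) (p := -γ) (Or.inl one_ne_zero)).tendsto_slope
    have h' := h.neg
    simp only [Real.one_rpow, mul_one, neg_neg] at h'
    refine h'.congr fun t => ?_
    rw [slope_def_field, Real.one_rpow, ← div_neg, neg_sub]
  have hlim : ∀ t : ℝ, 0 < t →
      Tendsto (fun x => (G (t * x) / G x - 1) / (1 - t)) atTop (𝓝 ((t ^ (-γ) - 1) / (1 - t))) :=
    fun t ht => ((hG t ht).sub_const 1).div_const _
  have hbound : ∀ t : ℝ, 0 < t → ∀ᶠ x in atTop,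
      (1 - t) * (x * f x / G x) ≤ G (t * x) / G x - 1 := by
    intro t ht
    filter_upwards [(tendsto_id.const_mul_atTop ht).eventually_ge_atTop x₀,
      eventually_ge_atTop x₀] with x h1 h2
    have h := (hdiff x (t * x) h2 h1).2
    rw [div_sub_one (hGpos x).ne', ← mul_div_assoc]
    gcongr
    · exact (hGpos x).le
    · linarith
  refine tendsto_order.2 ⟨fun a ha => ?_, fun a ha => ?_⟩
  · obtain ⟨t, ht, ht1⟩ := ((hslope.eventually_const_lt ha).filter_mono
      (nhdsWithin_mono 1 fun t (ht : t ∈ Set.Ioi 1) => ne_of_gt ht)).and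
      (self_mem_nhdsWithin) |>.exists
    have ht1 : 1 < t := ht1
    filter_upwards [(hlim t (by linarith)).eventually_const_lt ht, hbound t (by linarith)]
      with x h1 h2
    refine h1.trans_le ?_
    rw [div_le_iff_of_neg (by linarith)]
    linarith
  · obtain ⟨t, ht, ht1, ht0⟩ := (((hslope.eventually_lt_const ha).filter_mono
      (nhdsWithin_mono 1 fun t (ht : t ∈ Set.Iio 1) => ne_of_lt ht)).and
      ((eventually_mem_nhdsWithin : ∀ᶠ t in 𝓝[<] (1 : ℝ), t ∈ Set.Iio 1).and
      (nhdsWithin_le_nhds (lt_mem_nhds zero_lt_one)))).exists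
    have ht1 : t < 1 := ht1
    filter_upwards [(hlim t ht0).eventually_lt_const ht, hbound t ht0]
      with x h1 h2
    refine lt_of_le_of_lt ?_ h1
    rw [le_div_iff₀ (by linarith)]
    linarith

/-- Ratios of densities have the limits dictated by the ratios of tails. -/
lemma tendsto_density_ratio {G f y : ℝ → ℝ} {γ r s : ℝ} (hγ : γ ≠ 0)
    (hGpos : ∀ x, 0 < G x)
    (hu : Tendsto (fun x => x * f x / G x) atTop (𝓝 γ))
    (hy : Tendsto y atTop atTop)
    (hr : Tendsto (fun x => G (y x) / G x) atTop (𝓝 r))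
    (hs : Tendsto (fun x => x / y x) atTop (𝓝 s)) :
    Tendsto (fun x => f (y x) / f x) atTop (𝓝 (r * s)) := by
  have h := (((hu.comp hy).div hu hγ).mul hr).mul hs
  rw [div_self hγ, one_mul] at h
  refine h.congr' ?_
  filter_upwards [hy.eventually_gt_atTop 0, eventually_gt_atTop 0] with x h1 h2
  have := (hGpos x).ne'
  have := (hGpos (y x)).ne'
  simp only [Pi.div_apply, Function.comp_apply]
  by_cases hf : f x = 0
  · simp [hf]
  · field_simp

lemma tendsto_density_half_ratio {G f : ℝ → ℝ} {γ : ℝ} (hγ : γ ≠ 0)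
    (hGpos : ∀ x, 0 < G x) (hG : RegVary G (-γ))
    (hu : Tendsto (fun x => x * f x / G x) atTop (𝓝 γ)) :
    Tendsto (fun x => f (2⁻¹ * x) / f x) atTop (𝓝 ((2⁻¹ : ℝ) ^ (-γ) * 2)) := by
  refine tendsto_density_ratio hγ hGpos hu (tendsto_id.const_mul_atTop (by norm_num))
    (hG _ (by norm_num)) (tendsto_const_nhds.congr' ?_)
  filter_upwards [eventually_gt_atTop 0] with x hx
  field_simp

lemma tendsto_density_div_tail {G f : ℝ → ℝ} {γ : ℝ}
    (hu : Tendsto (fun x => x * f x / G x) atTop (𝓝 γ)) :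
    Tendsto (fun x => f x / G x) atTop (𝓝 0) := by
  have h := hu.mul tendsto_inv_atTop_zero
  rw [mul_zero] at h
  refine h.congr' ?_
  filter_upwards [eventually_gt_atTop 0] with x hx
  field_simp

lemma tendsto_tail_shift_ratio {G f : ℝ → ℝ} {γ x₀ : ℝ}
    (hGpos : ∀ x, 0 < G x) (hG : RegVary G (-γ))
    (hmono : ∀ x y, x₀ ≤ x → x ≤ y → f y ≤ f x)
    (hdiff : ∀ a b, x₀ ≤ a → x₀ ≤ b → (b - a) * f b ≤ G a - G b ∧ G a - G b ≤ (b - a) * f a)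
    (hu : Tendsto (fun x => x * f x / G x) atTop (𝓝 γ)) (hfpos : ∀ x, x₀ ≤ x → 0 < f x) (c : ℝ) :
    Tendsto (fun x => G (x + c) / G x) atTop (𝓝 1) := by
  have hhalf : Tendsto (fun x : ℝ => 2⁻¹ * x) atTop atTop :=
    tendsto_id.const_mul_atTop (by norm_num)
  have h0 : Tendsto (fun x => |c| * (f (2⁻¹ * x) / G x)) atTop (𝓝 0) := by
    have h := (((tendsto_density_div_tail hu).comp hhalf).mul (hG 2⁻¹ (by norm_num))).const_mul |c|
    rw [zero_mul, mul_zero] at h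
    refine h.congr fun x => ?_
    have := (hGpos (2⁻¹ * x)).ne'
    rw [Function.comp_apply, div_mul_div_cancel₀ this]
  rw [tendsto_iff_norm_sub_tendsto_zero]
  refine squeeze_zero' (Eventually.of_forall fun x => norm_nonneg _) ?_ h0
  filter_upwards [hhalf.eventually_ge_atTop x₀, eventually_ge_atTop (2 * |c|), eventually_gt_atTop 0]
    with x h1 h2 h3
  have hc1 := neg_abs_le c
  have hc2 := le_abs_self c
  have hxc : 2⁻¹ * x ≤ x + c := by linarith
  have hx : 2⁻¹ * x ≤ x := by linarith
  obtain ⟨ha, hb⟩ := hdiff x (x + c) (h1.trans hx) (h1.trans hxc)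
  have hf1 := hmono _ _ h1 hx
  have hf2 := hmono _ _ h1 hxc
  have hf3 := hfpos x (h1.trans hx)
  have hf4 := hfpos (x + c) (h1.trans hxc)
  rw [div_sub_one (hGpos x).ne', Real.norm_eq_abs, abs_div, abs_of_pos (hGpos x), mul_div_assoc']
  gcongr
  · exact (hGpos x).le
  rw [abs_le]
  rw [add_sub_cancel_left] at ha hb
  have k1 : c * f x ≤ |c| * f (2⁻¹ * x) := by gcongr
  have k2 : -c * f (x + c) ≤ |c| * f (2⁻¹ * x) := by
    gcongr
    exact neg_le_abs c
  constructor <;> linarith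

lemma tendsto_density_shift_ratio {G f : ℝ → ℝ} {γ x₀ : ℝ} (hγ : γ ≠ 0)
    (hGpos : ∀ x, 0 < G x) (hG : RegVary G (-γ))
    (hmono : ∀ x y, x₀ ≤ x → x ≤ y → f y ≤ f x)
    (hdiff : ∀ a b, x₀ ≤ a → x₀ ≤ b → (b - a) * f b ≤ G a - G b ∧ G a - G b ≤ (b - a) * f a)
    (hu : Tendsto (fun x => x * f x / G x) atTop (𝓝 γ)) (hfpos : ∀ x, x₀ ≤ x → 0 < f x) (c : ℝ) :
    Tendsto (fun x => f (x + c) / f x) atTop (𝓝 1) := by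
  have hs : Tendsto (fun x : ℝ => x / (x + c)) atTop (𝓝 1) := by
    have h := (tendsto_inv_atTop_zero.comp
      (tendsto_atTop_add_const_right atTop c tendsto_id)).const_mul c |>.const_sub 1
    rw [mul_zero, sub_zero] at h
    refine h.congr' ?_
    filter_upwards [eventually_gt_atTop (-c)] with x hx
    have : x + c ≠ 0 := by linarith
    simp only [Function.comp_apply, id]
    field_simp
    ring
  simpa using tendsto_density_ratio hγ hGpos hu (tendsto_atTop_add_const_right atTop c tendsto_id)
    (tendsto_tail_shift_ratio hGpos hG hmono hdiff hu hfpos c) hs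

lemma tendsto_tail_sub_div_density {G f : ℝ → ℝ} {x₀ : ℝ}
    (hdiff : ∀ a b, x₀ ≤ a → x₀ ≤ b → (b - a) * f b ≤ G a - G b ∧ G a - G b ≤ (b - a) * f a)
    (hfpos : ∀ x, x₀ ≤ x → 0 < f x) (c : ℝ)
    (hf : Tendsto (fun x => f (x + c) / f x) atTop (𝓝 1)) :
    Tendsto (fun x => (G x - G (x + c)) / f x) atTop (𝓝 c) := by
  have h := hf.const_mul c
  rw [mul_one] at h
  refine tendsto_of_tendsto_of_tendsto_of_le_of_le' h tendsto_const_nhds ?_ ?_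
  all_goals
    filter_upwards [eventually_ge_atTop x₀, eventually_ge_atTop (x₀ - c)] with x h1 h2
    obtain ⟨ha, hb⟩ := hdiff x (x + c) h1 (by linarith)
    have := hfpos x h1
    rw [add_sub_cancel_left] at ha hb
  · rw [mul_div_assoc']
    gcongr
  · rwa [div_le_iff₀ this]

lemma tendsto_shifted_tail_sub_div_density {H G f : ℝ → ℝ} {x₀ m : ℝ}
    (hfpos : ∀ x, x₀ ≤ x → 0 < f x)
    (hdiff : ∀ a b, x₀ ≤ a → x₀ ≤ b → (b - a) * f b ≤ G a - G b ∧ G a - G b ≤ (b - a) * f a)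
    (hshift : ∀ c, Tendsto (fun x => f (x + c) / f x) atTop (𝓝 1))
    (hm : Tendsto (fun x => (H x - G x) / f x) atTop (𝓝 m)) (c : ℝ) :
    Tendsto (fun x => (H (x + c) - G x) / f x) atTop (𝓝 (m - c)) := by
  have h := ((hm.comp (tendsto_atTop_add_const_right atTop c tendsto_id)).mul (hshift c)).sub
    (tendsto_tail_sub_div_density hdiff hfpos c (hshift c))
  rw [mul_one] at h
  refine h.congr' ?_
  filter_upwards [eventually_ge_atTop x₀, eventually_ge_atTop (x₀ - c)] with x h1 h2
  have := (hfpos x h1).ne'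
  have := (hfpos (x + c) (by linarith)).ne'
  simp only [Function.comp_apply, id]
  field_simp
  ring

lemma tail_nonneg {Ω : Type*} [MeasurableSpace Ω] {P : Measure Ω} {X : Ω → ℝ} (x : ℝ) :
    0 ≤ tail P X x :=
  ENNReal.toReal_nonneg

section TailLemmas

variable {Ω : Type*} [MeasurableSpace Ω] {P : Measure Ω} [IsProbabilityMeasure P] {X : Ω → ℝ}

lemma tail_le_one (x : ℝ) : tail P X x ≤ 1 := measureReal_le_one

lemma antitone_tail : Antitone (tail P X) := fun _ _ h =>
  measureReal_mono fun _ hω => lt_of_le_of_lt h hω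

lemma cdf'_eq_one_sub_tail (hX : Measurable X) (x : ℝ) : cdf' P X x = 1 - tail P X x := by
  have h := probReal_compl_eq_one_sub (μ := P) (measurableSet_lt (f := fun _ : Ω => x) measurable_const hX)
  rwa [show {ω | x < X ω}ᶜ = {ω | X ω ≤ x} by ext; simp] at h

lemma tendsto_tail_atTop (hX : Measurable X) : Tendsto (tail P X) atTop (𝓝 0) := by
  have := Measure.isProbabilityMeasure_map (μ := P) hX.aemeasurable
  have h := (tendsto_cdf_atTop (P.map X)).const_sub 1
  rw [sub_self] at h
  refine h.congr fun x => ?_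
  rw [cdf_eq_real, map_measureReal_apply hX measurableSet_Iic, ← sub_sub_cancel 1 (tail P X x),
    ← cdf'_eq_one_sub_tail hX]
  rfl

lemma tail_pos_of_frequently_ne_zero (h : ∃ᶠ x in atTop, tail P X x ≠ 0) (x : ℝ) :
    0 < tail P X x := by
  obtain ⟨y, hxy, hy⟩ := (frequently_atTop.1 h) x
  exact ((tail_nonneg y).lt_of_ne' hy).trans_le (antitone_tail hxy)

lemma VaR_le_of_tail_le (hX : Measurable X) (hpos : ∀ ω, 0 ≤ X ω) {α x : ℝ} (hα : 0 < α)
    (h : tail P X x ≤ 1 - α) : VaR P X α ≤ x := by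
  refine csInf_le ⟨0, fun y (hy : α ≤ cdf' P X y) => ?_⟩ ?_
  · by_contra! hy0
    have : cdf' P X y = 0 := by
      rw [cdf', show {ω | X ω ≤ y} = ∅ by
        ext ω; simpa using hy0.trans_le (hpos ω)]
      simp
    linarith
  · change α ≤ cdf' P X x
    rw [cdf'_eq_one_sub_tail hX]
    linarith

lemma le_VaR_of_lt_tail (hX : Measurable X) {α x : ℝ} (hα : α < 1)
    (h : 1 - α < tail P X x) : x ≤ VaR P X α := by
  refine le_csInf ?_ fun y (hy : α ≤ cdf' P X y) => ?_
  · obtain ⟨y, hy⟩ := ((tendsto_tail_atTop (P := P) hX).eventually_lt_const (sub_pos.2 hα)).exists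
    refine ⟨y, ?_⟩
    change α ≤ cdf' P X y
    rw [cdf'_eq_one_sub_tail hX]
    linarith
  · rw [cdf'_eq_one_sub_tail hX] at hy
    by_contra! hxy
    have := antitone_tail (P := P) (X := X) hxy.le
    linarith

lemma tendsto_VaR_atTop (hX : Measurable X) (h : ∀ x, 0 < tail P X x) :
    Tendsto (VaR P X) (𝓝[<] 1) atTop := by
  refine tendsto_atTop.2 fun x => ?_
  have h1 : 1 - tail P X x < 1 := by linarith [h x]
  filter_upwards [self_mem_nhdsWithin, nhdsWithin_le_nhds (lt_mem_nhds h1)] with α hα hα'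
  exact le_VaR_of_lt_tail hX hα (by linarith)

lemma integrable_of_tail_le_rpow (hX : Measurable X) (hpos : ∀ ω, 0 ≤ X ω) {p C : ℝ} (hp : p < -1)
    (h : ∀ᶠ x in atTop, tail P X x ≤ C * x ^ p) : Integrable X P := by
  obtain ⟨A, hA⟩ := eventually_atTop.1 (h.and (eventually_gt_atTop 0))
  have hA0 : 0 < A := (hA A le_rfl).2
  refine ⟨hX.aestronglyMeasurable, ?_⟩
  rw [hasFiniteIntegral_iff_ofReal (Eventually.of_forall hpos),
    lintegral_eq_lintegral_meas_lt P (Eventually.of_forall hpos) hX.aemeasurable,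
    ← Set.Ioc_union_Ioi_eq_Ioi hA0.le, lintegral_union measurableSet_Ioi
      (Set.Ioc_disjoint_Ioi le_rfl)]
  refine ENNReal.add_lt_top.2 ⟨?_, ?_⟩
  · calc ∫⁻ t in Set.Ioc 0 A, P {ω | t < X ω} ≤ ∫⁻ _ in Set.Ioc 0 A, 1 :=
        lintegral_mono fun _ => prob_le_one
      _ < ⊤ := by simp
  · have hint : IntegrableOn (fun t : ℝ => C * t ^ p) (Set.Ioi A) :=
      (integrableOn_Ioi_rpow_of_lt hp hA0).const_mul C
    refine lt_of_le_of_lt (setLIntegral_mono_ae' measurableSet_Ioi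
      (Eventually.of_forall fun t ht => ?_)) hint.lintegral_lt_top
    exact (ENNReal.le_ofReal_iff_toReal_le (measure_ne_top _ _)
      ((tail_nonneg t).trans (hA t (le_of_lt ht)).1)).2 (hA t (le_of_lt ht)).1

lemma tail_add_eq_integral {Y : Ω → ℝ} (hX : Measurable X) (hY : Measurable Y)
    (hindep : IndepFun X Y P) (x : ℝ) :
    tail P (fun ω => X ω + Y ω) x = ∫ ω, tail P Y (x - X ω) ∂P := by
  have := Measure.isProbabilityMeasure_map (μ := P) hX.aemeasurable
  have := Measure.isProbabilityMeasure_map (μ := P) hY.aemeasurable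
  have hs : MeasurableSet {p : ℝ × ℝ | x < p.1 + p.2} :=
    measurableSet_lt measurable_const (measurable_fst.add measurable_snd)
  have hmeas : Measurable fun ω => tail P Y (x - X ω) :=
    antitone_tail.measurable.comp (measurable_const.sub hX)
  rw [integral_eq_lintegral_of_nonneg_ae (Eventually.of_forall fun _ => tail_nonneg _)
    hmeas.aestronglyMeasurable, tail]
  congr 1
  calc P {ω | x < X ω + Y ω} = P.map (fun ω => (X ω, Y ω)) {p | x < p.1 + p.2} :=
        (Measure.map_apply (hX.prodMk hY) hs).symm
    _ = ∫⁻ l, P.map Y (Prod.mk l ⁻¹' {p | x < p.1 + p.2}) ∂(P.map X) := by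
        rw [(indepFun_iff_map_prod_eq_prod_map_map hX.aemeasurable hY.aemeasurable).1 hindep,
          Measure.prod_apply hs]
    _ = ∫⁻ ω, P.map Y (Prod.mk (X ω) ⁻¹' {p | x < p.1 + p.2}) ∂P :=
        lintegral_map (measurable_measure_prodMk_left hs) hX
    _ = ∫⁻ ω, ENNReal.ofReal (tail P Y (x - X ω)) ∂P := by
        refine lintegral_congr fun ω => ?_
        rw [Measure.map_apply hY (measurable_prodMk_left hs), tail,
          ENNReal.ofReal_toReal (measure_ne_top _ _)]
        congr 1
        ext ω'
        simp [sub_lt_iff_lt_add']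

lemma tail_sub_tail_bounds {x₀ : ℝ} {f : ℝ → ℝ} (hX : Measurable X)
    (hmono : ∀ x y, x₀ ≤ x → x ≤ y → f y ≤ f x)
    (hdens : ∀ x, x₀ ≤ x → cdf' P X x = cdf' P X x₀ + ∫ y in x₀..x, f y) (a b : ℝ)
    (ha : x₀ ≤ a) (hb : x₀ ≤ b) :
    (b - a) * f b ≤ tail P X a - tail P X b ∧ tail P X a - tail P X b ≤ (b - a) * f a := by
  have hint : ∀ u v, x₀ ≤ u → x₀ ≤ v → IntervalIntegrable f volume u v := fun u v hu hv =>
    AntitoneOn.intervalIntegrable fun s hs t _ hst => hmono s t ((le_min hu hv).trans hs.1) hst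
  have hsub : ∀ u v, x₀ ≤ u → x₀ ≤ v → tail P X u - tail P X v = ∫ y in u..v, f y := by
    intro u v hu hv
    rw [← intervalIntegral.integral_interval_sub_left (hint _ _ le_rfl hv) (hint _ _ le_rfl hu)]
    linarith [hdens u hu, hdens v hv, cdf'_eq_one_sub_tail (P := P) hX u,
      cdf'_eq_one_sub_tail (P := P) hX v]
  have key : ∀ u v, x₀ ≤ u → u ≤ v → (v - u) * f v ≤ tail P X u - tail P X v ∧
      tail P X u - tail P X v ≤ (v - u) * f u := by
    intro u v hu huv
    rw [hsub u v hu (hu.trans huv), ← smul_eq_mul, ← smul_eq_mul,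
      ← intervalIntegral.integral_const, ← intervalIntegral.integral_const]
    exact ⟨intervalIntegral.integral_mono_on huv (by simp) (hint _ _ hu (hu.trans huv))
        fun t ht => hmono t v (hu.trans ht.1) ht.2,
      intervalIntegral.integral_mono_on huv (hint _ _ hu (hu.trans huv)) (by simp)
        fun t ht => hmono u t hu ht.1⟩
  rcases le_total a b with h | h
  · exact key a b ha h
  · obtain ⟨h1, h2⟩ := key b a hb h
    constructor <;> linarith

/-- Adding an independent non-negative `X` shifts the tail of `Y` by `E[X]` to first order. -/
lemma tendsto_tail_add_sub_tail_div_density {Y : Ω → ℝ} {f : ℝ → ℝ} {x₀ r : ℝ}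
    (hX : Measurable X) (hY : Measurable Y) (hindep : IndepFun X Y P)
    (hpos : ∀ ω, 0 ≤ X ω) (hint : Integrable X P)
    (hmono : ∀ x y, x₀ ≤ x → x ≤ y → f y ≤ f x) (hfpos : ∀ x, x₀ ≤ x → 0 < f x)
    (hdiff : ∀ a b, x₀ ≤ a → x₀ ≤ b →
      (b - a) * f b ≤ tail P Y a - tail P Y b ∧ tail P Y a - tail P Y b ≤ (b - a) * f a)
    (hshift : ∀ c, Tendsto (fun x => f (x + c) / f x) atTop (𝓝 1))
    (hhalf : Tendsto (fun x => f (2⁻¹ * x) / f x) atTop (𝓝 r))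
    (hX_tail : Tendsto (fun x => tail P X (2⁻¹ * x) / f x) atTop (𝓝 0)) :
    Tendsto (fun x => (tail P (fun ω => X ω + Y ω) x - tail P Y x) / f x) atTop
      (𝓝 (∫ ω, X ω ∂P)) := by
  have hhalfTop : Tendsto (fun x : ℝ => 2⁻¹ * x) atTop atTop :=
    tendsto_id.const_mul_atTop (by norm_num)
  let g : ℝ → Ω → ℝ := fun x ω => tail P Y (x - X ω) - tail P Y x
  have hg_meas : ∀ x, Measurable (g x) := fun x =>
    (antitone_tail.measurable.comp (measurable_const.sub hX)).sub_const _
  have hg_nonneg : ∀ x ω, 0 ≤ g x ω := fun x ω =>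
    sub_nonneg.2 (antitone_tail (by linarith [hpos ω]))
  have hg_le : ∀ x ω, g x ω ≤ 1 := fun x ω => by
    have := tail_le_one (P := P) (X := Y) (x - X ω)
    have := tail_nonneg (P := P) (X := Y) x
    simp only [g]
    linarith
  have hg_int : ∀ x, Integrable (g x) P := fun x =>
    Integrable.of_bound (hg_meas x).aestronglyMeasurable 1
      (Eventually.of_forall fun ω => by
        rw [Real.norm_of_nonneg (hg_nonneg x ω)]
        exact hg_le x ω)
  let s : ℝ → Set Ω := fun x => {ω | X ω ≤ 2⁻¹ * x}
  have hs : ∀ x, MeasurableSet (s x) := fun x => measurableSet_le hX measurable_const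
  have hsplit : ∀ x, (tail P (fun ω => X ω + Y ω) x - tail P Y x) / f x =
      (∫ ω, (s x).indicator (g x) ω / f x ∂P) + (∫ ω in (s x)ᶜ, g x ω ∂P) / f x := by
    intro x
    rw [integral_div, integral_indicator (hs x), ← add_div, integral_add_compl (hs x) (hg_int x),
      tail_add_eq_integral hX hY hindep, integral_sub, integral_const, probReal_univ, one_smul]
    · exact ((hg_int x).add (integrable_const (tail P Y x))).congr
        (Eventually.of_forall fun ω => sub_add_cancel _ _)
    · exact integrable_const _
  have hbulk : Tendsto (fun x => ∫ ω, (s x).indicator (g x) ω / f x ∂P) atTop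
      (𝓝 (∫ ω, X ω ∂P)) := by
    refine tendsto_integral_filter_of_dominated_convergence (fun ω => (r + 1) * X ω)
      (Eventually.of_forall fun x =>
        (((hg_meas x).indicator (hs x)).div_const _).aestronglyMeasurable) ?_
      (hint.const_mul _) (Eventually.of_forall fun ω => ?_)
    · filter_upwards [hhalf.eventually_lt_const (lt_add_one r),
        hhalfTop.eventually_ge_atTop x₀, eventually_ge_atTop 0] with x hr h1 h2
      have hx : x₀ ≤ x := by linarith
      have hfx := hfpos x hx
      refine Eventually.of_forall fun ω => ?_
      have hr0 : 0 < r + 1 := (div_pos (hfpos _ h1) hfx).trans hr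
      by_cases hω : ω ∈ s x
      · have hω' : X ω ≤ 2⁻¹ * x := hω
        have hxX : 2⁻¹ * x ≤ x - X ω := by linarith
        rw [Set.indicator_of_mem hω, Real.norm_of_nonneg (div_nonneg (hg_nonneg x ω) hfx.le),
          div_le_iff₀ hfx]
        rw [div_lt_iff₀ hfx] at hr
        have hd := (hdiff (x - X ω) x (h1.trans hxX) hx).2
        rw [sub_sub_cancel] at hd
        calc g x ω ≤ X ω * f (x - X ω) := hd
          _ ≤ X ω * ((r + 1) * f x) :=
            mul_le_mul_of_nonneg_left ((hmono _ _ h1 hxX).trans hr.le) (hpos ω)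
          _ = (r + 1) * X ω * f x := by ring
      · rw [Set.indicator_of_notMem hω]
        simpa using mul_nonneg hr0.le (hpos ω)
    · have h := (tendsto_tail_sub_div_density hdiff hfpos _ (hshift (-X ω))).neg
      rw [neg_neg] at h
      refine h.congr' ?_
      filter_upwards [hhalfTop.eventually_ge_atTop (X ω)] with x hx
      rw [Set.indicator_of_mem (show ω ∈ s x from hx), ← neg_div, neg_sub, ← sub_eq_add_neg]
  have hrest : Tendsto (fun x => (∫ ω in (s x)ᶜ, g x ω ∂P) / f x) atTop (𝓝 0) := by
    refine squeeze_zero' ?_ ?_ hX_tail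
    all_goals filter_upwards [eventually_ge_atTop x₀] with x hx
    · exact div_nonneg (integral_nonneg (hg_nonneg x)) (hfpos x hx).le
    · refine div_le_div_of_nonneg_right ?_ (hfpos x hx).le
      calc ∫ ω in (s x)ᶜ, g x ω ∂P ≤ ∫ _ in (s x)ᶜ, (1 : ℝ) ∂P :=
            integral_mono (hg_int x).integrableOn (integrable_const _) (hg_le x)
        _ = tail P X (2⁻¹ * x) := by
          rw [setIntegral_const, smul_eq_mul, mul_one, tail, Measure.real]
          congr 2
          ext ω
          simp [s]
  have h := hbulk.add hrest
  rw [add_zero] at h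
  exact h.congr fun x => (hsplit x).symm

/-- Tail comparison up to shifts `m ± ε` transfers to quantiles. -/
lemma tendsto_VaR_sub_VaR {Y : Ω → ℝ} {m : ℝ} (hX : Measurable X) (hY : Measurable Y)
    (hXpos : ∀ ω, 0 ≤ X ω) (hYpos : ∀ ω, 0 ≤ Y ω) (hYtail : ∀ x, 0 < tail P Y x)
    (hlt : ∀ c, m < c → ∀ᶠ x in atTop, tail P X (x + c) < tail P Y x)
    (hgt : ∀ c, c < m → ∀ᶠ x in atTop, tail P Y x < tail P X (x + c)) :
    Tendsto (fun α => VaR P X α - VaR P Y α) (𝓝[<] 1) (𝓝 m) := by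
  have hq := tendsto_VaR_atTop (P := P) hY hYtail
  have hα0 : ∀ᶠ α : ℝ in 𝓝[<] 1, 0 < α := nhdsWithin_le_nhds (lt_mem_nhds one_pos)
  have hα1 : ∀ᶠ α : ℝ in 𝓝[<] 1, α < 1 := self_mem_nhdsWithin
  refine tendsto_order.2 ⟨fun a ha => ?_, fun a ha => ?_⟩
  · obtain ⟨c, hac, hcm⟩ := exists_between ha
    obtain ⟨A, hA⟩ := eventually_atTop.1 (hgt c hcm)
    filter_upwards [hα0, hα1, hq.eventually_gt_atTop A] with α h0 h1 hqA
    have : VaR P Y α + c ≤ VaR P X α := by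
      rw [← le_sub_iff_add_le]
      refine le_of_forall_lt_imp_le_of_dense fun y hy => ?_
      rw [le_sub_iff_add_le]
      have hz : max y A < VaR P Y α := max_lt hy hqA
      refine (add_le_add_left (le_max_left y A) c).trans (le_VaR_of_lt_tail hX h1 ?_)
      refine lt_trans ?_ (hA _ (le_max_right y A))
      by_contra! h
      exact (VaR_le_of_tail_le hY hYpos h0 h).not_gt hz
    linarith
  · obtain ⟨c, hmc, hca⟩ := exists_between ha
    obtain ⟨A, hA⟩ := eventually_atTop.1 (hlt c hmc)
    filter_upwards [hα0, hα1, hq.eventually_gt_atTop A] with α h0 h1 hqA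
    have : VaR P X α ≤ VaR P Y α + c := by
      rw [← sub_le_iff_le_add]
      refine le_of_forall_gt_imp_ge_of_dense fun y hy => ?_
      rw [sub_le_iff_le_add]
      refine VaR_le_of_tail_le hX hXpos h0 ((hA _ (hqA.trans hy).le).le.trans ?_)
      by_contra! h
      exact (le_VaR_of_lt_tail hY h1 h).not_gt hy
    linarith

end TailLemmas

theorem stmt10 {Ω : Type*} [MeasurableSpace Ω] (P : Measure Ω) [IsProbabilityMeasure P]
    (L S : Ω → ℝ) (hL : Measurable L) (hS : Measurable S)
    (hindep : IndepFun L S P)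
    (hLpos : ∀ ω, 0 ≤ L ω) (hSpos : ∀ ω, 0 ≤ S ω)
    (β γ k : ℝ) (hγ : 0 < γ) (hγβ : γ + 1 < β) (hk0 : 0 < k)
    (hRVL : RegVary (tail P L) (-β)) (hRVS : RegVary (tail P S) (-γ))
    (x₀ : ℝ) (hx₀ : 0 < x₀) (fS : ℝ → ℝ)
    (hfSpos : ∀ x, x₀ ≤ x → 0 < fS x)
    (hfSmono : ∀ x y, x₀ ≤ x → x ≤ y → fS y ≤ fS x)
    (hfSdens : ∀ x, x₀ ≤ x → cdf' P S x = cdf' P S x₀ + ∫ y in x₀..x, fS y)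
    (hk : Tendsto (fun x => x ^ (γ - β) * tail P S x / tail P L x) atTop (𝓝 k)) :
    Tendsto (fun α => VaR P (fun ω => L ω + S ω) α - VaR P S α)
      (𝓝[<] (1 : ℝ)) (𝓝 (∫ ω, L ω ∂P)) := by
  have hdiff := tail_sub_tail_bounds (P := P) hS hfSmono hfSdens
  have hSpos' : ∀ x, 0 < tail P S x := by
    refine tail_pos_of_frequently_ne_zero (Eventually.frequently ?_)
    filter_upwards [eventually_ge_atTop x₀] with x hx
    have h := (hdiff x (x + 1) hx (by linarith)).1
    have := hfSpos (x + 1) (by linarith)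
    have := tail_nonneg (P := P) (X := S) (x + 1)
    linarith
  have hk_ev := hk.eventually_const_lt (half_lt_self hk0)
  have hLtail_pos : ∀ x, 0 < tail P L x := by
    refine tail_pos_of_frequently_ne_zero (Eventually.frequently ?_)
    filter_upwards [hk_ev] with x hx h0
    rw [h0, div_zero] at hx
    linarith
  have hLint : Integrable L P := by
    refine integrable_of_tail_le_rpow (p := γ - β) (C := (k / 2)⁻¹) hL hLpos (by linarith) ?_
    filter_upwards [hk_ev, eventually_gt_atTop 0] with x hx hx0
    rw [lt_div_iff₀ (hLtail_pos x)] at hx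
    rw [← div_eq_inv_mul, le_div_iff₀ (half_pos hk0), mul_comm]
    exact hx.le.trans (mul_le_of_le_one_right (Real.rpow_nonneg hx0.le _) (tail_le_one x))
  have hu := tendsto_mul_density_div_tail hSpos' hRVS hdiff
  have hshift := tendsto_density_shift_ratio hγ.ne' hSpos' hRVS hfSmono hdiff hu hfSpos
  have hLtail : Tendsto (fun x => tail P L (2⁻¹ * x) / fS x) atTop (𝓝 0) := by
    have hpow : Tendsto (fun x : ℝ => x ^ (γ - β + 1)) atTop (𝓝 0) := by
      simpa using tendsto_rpow_neg_atTop (show 0 < -(γ - β + 1) by linarith)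
    have h := (((hRVL 2⁻¹ (by norm_num)).mul (hk.inv₀ hk0.ne')).mul hpow).mul (hu.inv₀ hγ.ne')
    rw [mul_zero, zero_mul] at h
    refine h.congr' ?_
    filter_upwards [eventually_gt_atTop 0, eventually_ge_atTop x₀] with x hx hx'
    have := (hSpos' x).ne'
    have := (hLtail_pos x).ne'
    have := (hfSpos x hx').ne'
    have := (Real.rpow_pos_of_pos hx (γ - β)).ne'
    rw [Real.rpow_add_one hx.ne']
    field_simp
  have hlim := tendsto_shifted_tail_sub_div_density hfSpos hdiff hshift
    (tendsto_tail_add_sub_tail_div_density hL hS hindep hLpos hLint hfSmono hfSpos hdiff hshift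
      (tendsto_density_half_ratio hγ.ne' hSpos' hRVS hu) hLtail)
  refine tendsto_VaR_sub_VaR (hL.add hS) hS (fun ω => add_nonneg (hLpos ω) (hSpos ω)) hSpos hSpos'
    (fun c hc => ?_) (fun c hc => ?_)
  · filter_upwards [(hlim c).eventually_lt_const (sub_neg.2 hc), eventually_ge_atTop x₀]
      with x h1 h2
    rw [div_lt_iff₀ (hfSpos x h2), zero_mul] at h1
    exact sub_neg.1 h1
  · filter_upwards [(hlim c).eventually_const_lt (sub_pos.2 hc), eventually_ge_atTop x₀]
      with x h1 h2
    rw [lt_div_iff₀ (hfSpos x h2), zero_mul] at h1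
    exact sub_pos.1 h1
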